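/- For every admissible prime p and all functions f0, f1, f2 : F_p^2 → ℂ (not necessarily bounded), defining F1(n1,h) = Σ_{n2∈F_p} Δ_{−h} f̂1(n1,n2) and F2(m2,h) = Σ_{m1∈F_p} Δ_{h} f̂2(m1,m2) for h ∈ F_p^2, one has |𝔼_{x1,x2,y} f0(x1,x2) f1(x1+P(y),x2) f2(x1,x2+Q(y))| ≤ ‖f0‖_2 · ‖F1(n1,h)‖_{ℓ^2_{n1,h}}^{1/2} · ‖F2(m2,h)‖_{ℓ^2_{m2,h}}^{1/4} · ‖conj(F2)(m2′,h)·F2(m2″,h)‖_{ℓ^2_{m2′,m2″,h}}^{1/8} · ( |Y(F_p)| / p^6 )^{1/16}, where Y(F_p) is the set of F_p-points of the Roth variety for corners associated to P, Q. -/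

import Mathlib

open scoped BigOperators ComplexOrder
open Polynomial

noncomputable section

namespace RatCorners

/-- Reduction of a rational number modulo `p` (genuine when `p` does not divide the
denominator). -/
def ratRed (p : ℕ) (q : ℚ) : ZMod p := (q.num : ZMod p) * (q.den : ZMod p)⁻¹

/-- Coefficientwise reduction of a polynomial with rational coefficients modulo `p`. -/
def polyRed (p : ℕ) (f : Polynomial ℚ) : Polynomial (ZMod p) :=
  f.sum fun n a => Polynomial.C (ratRed p a) * Polynomial.X ^ n

/-- `p` divides no denominator of any coefficient of `P` (with numerator and denominator
of `P` in lowest terms). -/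
def Admissible (p : ℕ) (P : RatFunc ℚ) : Prop :=
  (∀ n, ¬ p ∣ (P.num.coeff n).den) ∧ ∀ n, ¬ p ∣ (P.denom.coeff n).den

/-- `y` is a pole of the reduction of `P` modulo `p`. -/
def IsPole (p : ℕ) (P : RatFunc ℚ) (y : ZMod p) : Prop :=
  (polyRed p P.denom).eval y = 0

instance (p : ℕ) (P : RatFunc ℚ) : DecidablePred (IsPole p P) := fun y =>
  inferInstanceAs (Decidable ((polyRed p P.denom).eval y = 0))

/-- Evaluation of the reduction of `P` modulo `p` at `y` (junk value `0` at poles). -/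
def evalRed (p : ℕ) (P : RatFunc ℚ) (y : ZMod p) : ZMod p :=
  (polyRed p P.num).eval y * ((polyRed p P.denom).eval y)⁻¹

/-- A function is `1`-bounded if all its values have norm at most `1`. -/
def OneBounded {α : Type*} (f : α → ℂ) : Prop := ∀ x, ‖f x‖ ≤ 1

/-- The formal derivative of a rational function. -/
def ratDeriv (P : RatFunc ℚ) : RatFunc ℚ :=
  algebraMap (Polynomial ℚ) (RatFunc ℚ)
      (Polynomial.derivative P.num * P.denom - P.num * Polynomial.derivative P.denom) /
    algebraMap (Polynomial ℚ) (RatFunc ℚ) (P.denom ^ 2)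

/-- Substitution of the variable `y i` into a rational function `P ∈ ℚ(t)`, producing an
element of the rational function field `ℚ(y 0, …, y (n-1))`. -/
def substAt {n : ℕ} (P : RatFunc ℚ) (i : Fin n) : FractionRing (MvPolynomial (Fin n) ℚ) :=
  Polynomial.eval₂
      ((algebraMap (MvPolynomial (Fin n) ℚ) (FractionRing (MvPolynomial (Fin n) ℚ))).comp
        MvPolynomial.C)
      (algebraMap (MvPolynomial (Fin n) ℚ) (FractionRing (MvPolynomial (Fin n) ℚ))
        (MvPolynomial.X i)) P.num /
    Polynomial.eval₂
      ((algebraMap (MvPolynomial (Fin n) ℚ) (FractionRing (MvPolynomial (Fin n) ℚ))).comp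
        MvPolynomial.C)
      (algebraMap (MvPolynomial (Fin n) ℚ) (FractionRing (MvPolynomial (Fin n) ℚ))
        (MvPolynomial.X i)) P.denom

variable (p : ℕ) [NeZero p]

/-- The counting operator `𝔼_{x₁,x₂,y} f₀(x₁,x₂) f₁(x₁+P(y),x₂) f₂(x₁,x₂+Q(y))`,
where the average in `y` avoids the poles of `P` and `Q` but is still normalized by `1/p`. -/
def cornerAvg (P Q : RatFunc ℚ) (f0 f1 f2 : ZMod p × ZMod p → ℂ) : ℂ :=
  (p : ℂ)⁻¹ ^ 3 * ∑ x1 : ZMod p, ∑ x2 : ZMod p, ∑ y : ZMod p,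
    if ¬ IsPole p P y ∧ ¬ IsPole p Q y then
      f0 (x1, x2) * f1 (x1 + evalRed p P y, x2) * f2 (x1, x2 + evalRed p Q y)
    else 0

/-- The main term `𝔼_{x₁,x₂} f₀(x₁,x₂) · 𝔼_a f₁(a,x₂) · 𝔼_b f₂(x₁,b)`. -/
def mainTerm (f0 f1 f2 : ZMod p × ZMod p → ℂ) : ℂ :=
  (p : ℂ)⁻¹ ^ 2 * ∑ x1 : ZMod p, ∑ x2 : ZMod p,
    f0 (x1, x2) * ((p : ℂ)⁻¹ * ∑ a : ZMod p, f1 (a, x2)) *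
      ((p : ℂ)⁻¹ * ∑ b : ZMod p, f2 (x1, b))

/-- The `L^r` norm with respect to the uniform probability measure on `(ZMod p)²`. -/
def Lnorm (r : ℝ) (f : ZMod p × ZMod p → ℂ) : ℝ :=
  ((p : ℝ)⁻¹ ^ 2 * ∑ x : ZMod p × ZMod p, ‖f x‖ ^ r) ^ r⁻¹

/-- The Gowers norm `‖f‖_{U²(0×F_p)}` along the second coordinate axis. -/
def U2vert (f : ZMod p × ZMod p → ℂ) : ℝ :=
  ((p : ℝ)⁻¹ ^ 4 * (∑ x : ZMod p × ZMod p, ∑ h : ZMod p, ∑ k : ZMod p,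
      f x * (starRingEnd ℂ) (f (x + (0, h))) * (starRingEnd ℂ) (f (x + (0, k))) *
        f (x + (0, h + k))).re) ^ ((4:ℝ)⁻¹)

/-- The Gowers norm `‖f‖_{U²(F_p×0)}` along the first coordinate axis. -/
def U2horiz (f : ZMod p × ZMod p → ℂ) : ℝ :=
  ((p : ℝ)⁻¹ ^ 4 * (∑ x : ZMod p × ZMod p, ∑ h : ZMod p, ∑ k : ZMod p,
      f x * (starRingEnd ℂ) (f (x + (h, 0))) * (starRingEnd ℂ) (f (x + (k, 0))) *
        f (x + (h + k, 0))).re) ^ ((4:ℝ)⁻¹)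

/-- The additive character `e_p(x) = e^{2πix/p}` on `ZMod p`. -/
def ep (x : ZMod p) : ℂ := Complex.exp (2 * Real.pi * Complex.I * (x.val : ℂ) / (p : ℂ))

/-- `e(r) = e^{2πir}` for a real number `r`. -/
def eC (r : ℝ) : ℂ := Complex.exp (2 * Real.pi * Complex.I * (r : ℂ))

/-- The Fourier transform `f̂(ξ) = 𝔼_x f(x) e_p(−x·ξ)` on `(ZMod p)²`. -/
def dft (f : ZMod p × ZMod p → ℂ) (ξ : ZMod p × ZMod p) : ℂ :=
  (p : ℂ)⁻¹ ^ 2 * ∑ x : ZMod p × ZMod p, f x * ep p (-(x.1 * ξ.1 + x.2 * ξ.2))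

/-- `F₁(n₁,𝐡) = ∑_{n₂} Δ_{−𝐡} f̂₁(n₁,n₂)` where `Δ_h g(x) = g(x)·conj g(x+h)`. -/
def F1 (f : ZMod p × ZMod p → ℂ) (n1 : ZMod p) (h : ZMod p × ZMod p) : ℂ :=
  ∑ n2 : ZMod p, dft p f (n1, n2) * (starRingEnd ℂ) (dft p f ((n1, n2) + -h))

/-- `F₂(m₂,𝐡) = ∑_{m₁} Δ_{𝐡} f̂₂(m₁,m₂)` where `Δ_h g(x) = g(x)·conj g(x+h)`. -/
def F2 (f : ZMod p × ZMod p → ℂ) (m2 : ZMod p) (h : ZMod p × ZMod p) : ℂ :=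
  ∑ m1 : ZMod p, dft p f (m1, m2) * (starRingEnd ℂ) (dft p f ((m1, m2) + h))

/-- The `F_p`-points of the Roth variety for corners associated to `P, Q`:
tuples `(y₁,…,y₁₆)` (indexed here by `0,…,15`) avoiding all poles of `P` and `Q` and
satisfying the ten defining equations. -/
def IsRothPoint (P Q : RatFunc ℚ) (y : Fin 16 → ZMod p) : Prop :=
  (∀ i, ¬ IsPole p P (y i)) ∧ (∀ i, ¬ IsPole p Q (y i)) ∧
  evalRed p P (y 0) - evalRed p P (y 2) - evalRed p P (y 8) + evalRed p P (y 10) = 0 ∧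
  evalRed p P (y 1) - evalRed p P (y 3) - evalRed p P (y 9) + evalRed p P (y 11) = 0 ∧
  evalRed p P (y 4) - evalRed p P (y 6) - evalRed p P (y 12) + evalRed p P (y 14) = 0 ∧
  evalRed p P (y 5) - evalRed p P (y 7) - evalRed p P (y 13) + evalRed p P (y 15) = 0 ∧
  evalRed p Q (y 0) - evalRed p Q (y 1) - evalRed p Q (y 8) + evalRed p Q (y 9) = 0 ∧
  evalRed p Q (y 2) - evalRed p Q (y 6) - evalRed p Q (y 10) + evalRed p Q (y 14) = 0 ∧
  evalRed p Q (y 3) - evalRed p Q (y 7) - evalRed p Q (y 11) + evalRed p Q (y 15) = 0 ∧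
  evalRed p Q (y 4) - evalRed p Q (y 5) - evalRed p Q (y 12) + evalRed p Q (y 13) = 0 ∧
  evalRed p P (y 8) - evalRed p P (y 9) - evalRed p P (y 10) + evalRed p P (y 11) -
      evalRed p P (y 12) + evalRed p P (y 13) + evalRed p P (y 14) - evalRed p P (y 15) = 0 ∧
  evalRed p Q (y 8) - evalRed p Q (y 9) - evalRed p Q (y 10) + evalRed p Q (y 11) -
      evalRed p Q (y 12) + evalRed p Q (y 13) + evalRed p Q (y 14) - evalRed p Q (y 15) = 0

/-- `|Y(F_p)|`, the number of `F_p`-points of the Roth variety for corners. -/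
def rothCard (P Q : RatFunc ℚ) : ℕ :=
  Nat.card {y : Fin 16 → ZMod p // IsRothPoint p P Q y}

/-- `χ` is an eigenfunction with respect to the first coordinate:
`χ(x₁,x₂) = 1_E(x₂) e_p(φ(x₂)x₁) e(ψ(x₂))`. -/
def IsEigen1 (χ : ZMod p × ZMod p → ℂ) : Prop :=
  ∃ (E : Finset (ZMod p)) (φ : ZMod p → ZMod p) (ψ : ZMod p → ℝ),
    ∀ x1 x2 : ZMod p,
      χ (x1, x2) = (if x2 ∈ E then 1 else 0) * ep p (φ x2 * x1) * eC (ψ x2)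

/-- `χ` is an eigenfunction with respect to the second coordinate:
`χ(x₁,x₂) = 1_E(x₁) e_p(φ(x₁)x₂) e(ψ(x₁))`. -/
def IsEigen2 (χ : ZMod p × ZMod p → ℂ) : Prop :=
  ∃ (E : Finset (ZMod p)) (φ : ZMod p → ZMod p) (ψ : ZMod p → ℝ),
    ∀ x1 x2 : ZMod p,
      χ (x1, x2) = (if x1 ∈ E then 1 else 0) * ep p (φ x1 * x2) * eC (ψ x1)

/-- The two-term counting operator `𝔼_{x₁,x₂,y} f₀(x₁,x₂) f₁(x₁+P(y),x₂)`. -/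
def twoAvg1 (P : RatFunc ℚ) (f0 f1 : ZMod p × ZMod p → ℂ) : ℂ :=
  (p : ℂ)⁻¹ ^ 3 * ∑ x1 : ZMod p, ∑ x2 : ZMod p, ∑ y : ZMod p,
    if ¬ IsPole p P y then f0 (x1, x2) * f1 (x1 + evalRed p P y, x2) else 0

/-- The two-term counting operator `𝔼_{x₁,x₂,y} f₀(x₁,x₂) f₁(x₁,x₂+P(y))`. -/
def twoAvg2 (P : RatFunc ℚ) (f0 f1 : ZMod p × ZMod p → ℂ) : ℂ :=
  (p : ℂ)⁻¹ ^ 3 * ∑ x1 : ZMod p, ∑ x2 : ZMod p, ∑ y : ZMod p,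
    if ¬ IsPole p P y then f0 (x1, x2) * f1 (x1, x2 + evalRed p P y) else 0

open scoped ComplexConjugate

section AdditiveCharacter

variable {p : ℕ} [NeZero p]

lemma ep_eq_stdAddChar (x : ZMod p) : ep p x = ZMod.stdAddChar x := by
  rw [ZMod.stdAddChar_apply, ZMod.toCircle_apply, ep]

lemma ep_add (x y : ZMod p) : ep p (x + y) = ep p x * ep p y := by
  simp only [ep_eq_stdAddChar, AddChar.map_add_eq_mul]

lemma ep_zero : ep p 0 = 1 := by
  simp only [ep_eq_stdAddChar, AddChar.map_zero_eq_one]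

lemma conj_ep (x : ZMod p) : conj (ep p x) = ep p (-x) := by
  simp only [ep_eq_stdAddChar, AddChar.map_neg_eq_conj]

lemma sum_ep_mul (a : ZMod p) :
    ∑ n : ZMod p, ep p (n * a) = if a = 0 then (p : ℂ) else 0 := by
  simp only [ep_eq_stdAddChar]
  rw [AddChar.sum_mulShift a (ZMod.isPrimitive_stdAddChar p)]
  split_ifs <;> simp [ZMod.card]

lemma sum_ep_dot (a b : ZMod p) :
    ∑ x : ZMod p × ZMod p, ep p (x.1 * a + x.2 * b) =
      if a = 0 ∧ b = 0 then (p : ℂ) ^ 2 else 0 := by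
  simp only [ep_add, Fintype.sum_prod_type]
  rw [← Finset.sum_mul_sum, sum_ep_mul, sum_ep_mul]
  by_cases ha : a = 0 <;> by_cases hb : b = 0 <;> simp [ha, hb, sq]

/-- Fourier inversion on `(ZMod p)²`. -/
lemma sum_dft_mul_ep (f : ZMod p × ZMod p → ℂ) (x : ZMod p × ZMod p) :
    ∑ ξ, dft p f ξ * ep p (x.1 * ξ.1 + x.2 * ξ.2) = f x := by
  have hp : (p : ℂ) ≠ 0 := NeZero.ne _
  calc ∑ ξ, dft p f ξ * ep p (x.1 * ξ.1 + x.2 * ξ.2)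
      = (p : ℂ)⁻¹ ^ 2 * ∑ y, f y * ∑ ξ : ZMod p × ZMod p,
          ep p (ξ.1 * (x.1 - y.1) + ξ.2 * (x.2 - y.2)) := by
        simp only [dft, Finset.mul_sum, Finset.sum_mul]
        rw [Finset.sum_comm]
        refine Finset.sum_congr rfl fun y _ => Finset.sum_congr rfl fun ξ _ => ?_
        rw [mul_assoc, mul_assoc, ← ep_add]
        congr 3
        ring
    _ = f x := by
        simp only [sum_ep_dot, sub_eq_zero, ← Prod.ext_iff, mul_ite, mul_zero, Finset.sum_ite_eq,
          Finset.mem_univ, if_true]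
        field_simp

/-- Parseval's identity on `(ZMod p)²`. -/
lemma sum_norm_sq_sum_mul_ep (c : ZMod p × ZMod p → ℂ) :
    ((p : ℝ)⁻¹ ^ 2 * ∑ x : ZMod p × ZMod p,
      ‖∑ k, c k * ep p (x.1 * k.1 + x.2 * k.2)‖ ^ 2) = ∑ k, ‖c k‖ ^ 2 := by
  have hp : (p : ℂ) ≠ 0 := NeZero.ne _
  apply Complex.ofReal_injective
  push_cast
  simp only [← Complex.mul_conj', map_sum, map_mul, conj_ep, Finset.sum_mul_sum]
  calc (p : ℂ)⁻¹ ^ 2 * ∑ x : ZMod p × ZMod p, ∑ k, ∑ l,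
        c k * ep p (x.1 * k.1 + x.2 * k.2) * (conj (c l) * ep p (-(x.1 * l.1 + x.2 * l.2)))
      = (p : ℂ)⁻¹ ^ 2 * ∑ k, ∑ l, c k * conj (c l) * ∑ x : ZMod p × ZMod p,
          ep p (x.1 * (k.1 - l.1) + x.2 * (k.2 - l.2)) := by
        rw [Finset.sum_comm]
        congr 1
        refine Finset.sum_congr rfl fun k _ => ?_
        rw [Finset.sum_comm]
        refine Finset.sum_congr rfl fun l _ => ?_
        rw [Finset.mul_sum]
        refine Finset.sum_congr rfl fun x _ => ?_
        rw [mul_mul_mul_comm, ← ep_add]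
        congr 2
        ring
    _ = ∑ k, c k * conj (c k) := by
        simp only [sum_ep_dot, sub_eq_zero, ← Prod.ext_iff, mul_ite, mul_zero, Finset.sum_ite_eq,
          Finset.mem_univ, if_true, ← Finset.sum_mul]
        field_simp

lemma expSum_mul_conj {α : Type*} (A : Finset α) (f g : α → ZMod p) :
    (∑ a ∈ A, ep p (f a)) * conj (∑ a ∈ A, ep p (g a)) =
      ∑ x ∈ A ×ˢ A, ep p (f x.1 - g x.2) := by
  rw [map_sum, Finset.sum_mul_sum, ← Finset.sum_product']
  refine Finset.sum_congr rfl fun x _ => ?_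
  rw [conj_ep, ← ep_add, sub_eq_add_neg]

/-- Summing a product of two exponential sums over one frequency restricts to the pairs
on which the corresponding phases agree. -/
lemma sum_expSum_mul_conj {α : Type*} (A : Finset α) (φ e e' : α → ZMod p) :
    ∑ n : ZMod p, (∑ a ∈ A, ep p (n * φ a + e a)) * conj (∑ a ∈ A, ep p (n * φ a + e' a)) =
      p * ∑ x ∈ (A ×ˢ A).filter (fun x => φ x.1 = φ x.2), ep p (e x.1 - e' x.2) := by
  simp only [expSum_mul_conj]
  rw [Finset.sum_comm, Finset.sum_filter, Finset.mul_sum]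
  refine Finset.sum_congr rfl fun x _ => ?_
  calc ∑ n : ZMod p, ep p (n * φ x.1 + e x.1 - (n * φ x.2 + e' x.2))
      = (∑ n : ZMod p, ep p (n * (φ x.1 - φ x.2))) * ep p (e x.1 - e' x.2) := by
        rw [Finset.sum_mul]
        refine Finset.sum_congr rfl fun n _ => ?_
        rw [← ep_add]
        congr 1
        ring
    _ = _ := by
        rw [sum_ep_mul]
        simp only [sub_eq_zero]
        split_ifs <;> simp

lemma sum_norm_sq_expSum {α : Type*} (A : Finset α) (φ₁ φ₂ φ₃ φ₄ : α → ZMod p) :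
    ∑ n₁ : ZMod p, ∑ n₂ : ZMod p, ∑ h : ZMod p × ZMod p,
        ‖∑ a ∈ A, ep p (n₁ * φ₁ a + n₂ * φ₂ a + (h.1 * φ₃ a + h.2 * φ₄ a))‖ ^ 2 =
      (p : ℝ) ^ 4 * ((A ×ˢ A).filter (fun x => φ₁ x.1 = φ₁ x.2 ∧ φ₂ x.1 = φ₂ x.2 ∧
        φ₃ x.1 = φ₃ x.2 ∧ φ₄ x.1 = φ₄ x.2)).card := by
  apply Complex.ofReal_injective
  push_cast
  simp only [← Complex.mul_conj', expSum_mul_conj, Finset.card_filter, Nat.cast_sum,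
    Finset.mul_sum]
  calc ∑ n₁ : ZMod p, ∑ n₂ : ZMod p, ∑ h : ZMod p × ZMod p, ∑ x ∈ A ×ˢ A,
          ep p (n₁ * φ₁ x.1 + n₂ * φ₂ x.1 + (h.1 * φ₃ x.1 + h.2 * φ₄ x.1) -
            (n₁ * φ₁ x.2 + n₂ * φ₂ x.2 + (h.1 * φ₃ x.2 + h.2 * φ₄ x.2)))
      = ∑ n₁ : ZMod p, ∑ n₂ : ZMod p, ∑ h : ZMod p × ZMod p, ∑ x ∈ A ×ˢ A,
          ep p (n₁ * (φ₁ x.1 - φ₁ x.2)) * (ep p (n₂ * (φ₂ x.1 - φ₂ x.2)) *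
            ep p (h.1 * (φ₃ x.1 - φ₃ x.2) + h.2 * (φ₄ x.1 - φ₄ x.2))) := by
        refine Finset.sum_congr rfl fun n₁ _ => Finset.sum_congr rfl fun n₂ _ =>
          Finset.sum_congr rfl fun h _ => Finset.sum_congr rfl fun x _ => ?_
        rw [← ep_add, ← ep_add]
        congr 1
        ring
    _ = ∑ x ∈ A ×ˢ A, (∑ n : ZMod p, ep p (n * (φ₁ x.1 - φ₁ x.2))) *
          ((∑ n : ZMod p, ep p (n * (φ₂ x.1 - φ₂ x.2))) * ∑ h : ZMod p × ZMod p,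
            ep p (h.1 * (φ₃ x.1 - φ₃ x.2) + h.2 * (φ₄ x.1 - φ₄ x.2))) := by
        simp only [Finset.sum_comm (t := A ×ˢ A)]
        refine Finset.sum_congr rfl fun x _ => ?_
        simp only [← Finset.mul_sum, ← Finset.sum_mul]
    _ = _ := by
        refine Finset.sum_congr rfl fun x _ => ?_
        simp only [sum_ep_mul, sum_ep_dot, sub_eq_zero]
        by_cases h₁ : φ₁ x.1 = φ₁ x.2 <;> by_cases h₂ : φ₂ x.1 = φ₂ x.2 <;>
          by_cases h₃ : φ₃ x.1 = φ₃ x.2 <;> by_cases h₄ : φ₄ x.1 = φ₄ x.2 <;>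
          simp [h₁, h₂, h₃, h₄]
        ring

end AdditiveCharacter

section CauchySchwarz

variable {ι κ η : Type*} [Fintype ι] [Fintype κ] [Fintype η]

lemma norm_sum_mul_sq_le (a b : ι → ℂ) :
    ‖∑ i, a i * b i‖ ^ 2 ≤ (∑ i, ‖a i‖ ^ 2) * ∑ i, ‖b i‖ ^ 2 := by
  refine le_trans ?_
    (Finset.sum_mul_sq_le_sq_mul_sq Finset.univ (fun i => ‖a i‖) fun i => ‖b i‖)
  gcongr
  simpa only [norm_mul] using norm_sum_le Finset.univ fun i => a i * b i

lemma norm_sum_sum_mul_sq_le (a b : ι → κ → ℂ) :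
    ‖∑ i, ∑ j, a i j * b i j‖ ^ 2 ≤
      (∑ i, ∑ j, ‖a i j‖ ^ 2) * ∑ i, ∑ j, ‖b i j‖ ^ 2 := by
  simpa only [Fintype.sum_prod_type] using
    norm_sum_mul_sq_le (fun x : ι × κ => a x.1 x.2) fun x => b x.1 x.2

/-- Expanding the square of a family of linear forms through the Gram matrix of its kernel. -/
lemma sum_norm_sq_sum_mul (F : κ → η → ℂ) (L : ι → κ → η → ℂ) :
    ((∑ n, ∑ h, ‖∑ m, F m h * L n m h‖ ^ 2 : ℝ) : ℂ) =
      ∑ m, ∑ m', ∑ h, F m h * conj (F m' h) * ∑ n, L n m h * conj (L n m' h) := by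
  push_cast
  simp only [← Complex.mul_conj', map_sum, map_mul, Finset.sum_mul_sum]
  simp only [Finset.mul_sum,
    Finset.sum_comm (s := (Finset.univ : Finset κ)) (t := (Finset.univ : Finset η)),
    Finset.sum_comm (s := (Finset.univ : Finset κ)) (t := (Finset.univ : Finset ι))]
  rw [Finset.sum_comm]
  refine Finset.sum_congr rfl fun h _ => Finset.sum_congr rfl fun n _ =>
    Finset.sum_congr rfl fun m _ => Finset.sum_congr rfl fun m' _ => ?_
  ring

/-- Two applications of the Cauchy–Schwarz inequality bound the second moment of a linear form
by its coefficients and the Gram matrix of the Gram matrix of its kernel. -/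
lemma sum_norm_sq_sum_mul_pow_le (F : κ → η → ℂ) (L : ι → κ → η → ℂ) (S : κ → κ → η → ℂ)
    (hS : ∀ m m' h, S m m' h = ∑ n, L n m' h * conj (L n m h)) :
    (∑ n, ∑ h, ‖∑ m, F m h * L n m h‖ ^ 2) ^ 4 ≤
      (∑ m, ∑ h, ‖F m h‖ ^ 2) ^ 2 * (∑ m, ∑ m', ∑ h, ‖conj (F m h) * F m' h‖ ^ 2) *
        ∑ m, ∑ m', ∑ h, ‖∑ k, S m k h * conj (S m' k h)‖ ^ 2 := by
  set B : ℝ := ∑ n, ∑ h, ‖∑ m, F m h * L n m h‖ ^ 2 with hB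
  set D : ℝ := ∑ k, ∑ h, ‖∑ m, conj (F m h) * S m k h‖ ^ 2 with hD
  have hB0 : 0 ≤ B := by positivity
  have hD0 : 0 ≤ D := by positivity
  have hBD : B ^ 2 ≤ (∑ m, ∑ h, ‖F m h‖ ^ 2) * D := by
    have hB' : (B : ℂ) = ∑ m, ∑ h, F m h * ∑ m', conj (F m' h) * S m' m h := by
      rw [hB, sum_norm_sq_sum_mul]
      refine Finset.sum_congr rfl fun m _ => ?_
      rw [Finset.sum_comm]
      refine Finset.sum_congr rfl fun h _ => ?_
      rw [Finset.mul_sum]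
      refine Finset.sum_congr rfl fun m' _ => ?_
      rw [hS, mul_assoc]
    have h := norm_sum_sum_mul_sq_le F fun m h => ∑ m', conj (F m' h) * S m' m h
    rwa [← hB', Complex.norm_real, Real.norm_of_nonneg hB0] at h
  have hDE : D ^ 2 ≤ (∑ m, ∑ m', ∑ h, ‖conj (F m h) * F m' h‖ ^ 2) *
      ∑ m, ∑ m', ∑ h, ‖∑ k, S m k h * conj (S m' k h)‖ ^ 2 := by
    have hD' := sum_norm_sq_sum_mul (fun m h => conj (F m h)) fun k m h => S m k h
    simp only [RCLike.conj_conj] at hD'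
    have h := norm_sum_sum_mul_sq_le (fun m (x : κ × η) => conj (F m x.2) * F x.1 x.2)
      fun m x => ∑ k, S m k x.2 * conj (S x.1 k x.2)
    simp only [Fintype.sum_prod_type] at h
    rwa [← hD', Complex.norm_real, Real.norm_of_nonneg hD0] at h
  calc B ^ 4 = (B ^ 2) ^ 2 := by ring
    _ ≤ ((∑ m, ∑ h, ‖F m h‖ ^ 2) * D) ^ 2 := by gcongr
    _ = (∑ m, ∑ h, ‖F m h‖ ^ 2) ^ 2 * D ^ 2 := by ring
    _ ≤ (∑ m, ∑ h, ‖F m h‖ ^ 2) ^ 2 * ((∑ m, ∑ m', ∑ h, ‖conj (F m h) * F m' h‖ ^ 2) *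
        ∑ m, ∑ m', ∑ h, ‖∑ k, S m k h * conj (S m' k h)‖ ^ 2) := by gcongr
    _ = _ := by ring

end CauchySchwarz

section Kernel

variable {p : ℕ} [NeZero p] (D : Finset (ZMod p)) (u v : ZMod p → ZMod p)

/-- The normalized exponential sum `𝔼_y e_p(a u(y) + b v(y))` over `y ∈ D`. -/
def expAvg (a b : ZMod p) : ℂ := (p : ℂ)⁻¹ * ∑ y ∈ D, ep p (a * u y + b * v y)

/-- The difference of `expAvg` in the direction `(-h.1, h.2)`. -/
def expAvgDiff (n m : ZMod p) (h : ZMod p × ZMod p) : ℂ :=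
  expAvg D u v n m * conj (expAvg D u v (n - h.1) (m + h.2))

/-- The Gram matrix of `expAvgDiff` over its first frequency. -/
def expAvgGram (m m' : ZMod p) (h : ZMod p × ZMod p) : ℂ :=
  ∑ n, expAvgDiff D u v n m' h * conj (expAvgDiff D u v n m h)

/-- Pairs of points of `D × D` with equal differences of `u`, written as nested pairs. -/
def eqDiffPairs : Finset ((ZMod p × ZMod p) × (ZMod p × ZMod p)) :=
  ((D ×ˢ D) ×ˢ (D ×ˢ D)).filter fun s => u s.1.1 - u s.1.2 = u s.2.1 - u s.2.2

/-- Pairs of elements of `eqDiffPairs` whose first components have equal differences of `v`. -/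
def eqDiffQuads : Finset (((ZMod p × ZMod p) × (ZMod p × ZMod p)) ×
    ((ZMod p × ZMod p) × (ZMod p × ZMod p))) :=
  (eqDiffPairs D u ×ˢ eqDiffPairs D u).filter fun r =>
    v r.1.1.1 - v r.1.1.2 = v r.2.1.1 - v r.2.1.2

/-- Pairs of elements of `eqDiffQuads` on which the remaining four phases agree. -/
def eqPhasePairs : Finset ((((ZMod p × ZMod p) × (ZMod p × ZMod p)) ×
    ((ZMod p × ZMod p) × (ZMod p × ZMod p))) × (((ZMod p × ZMod p) × (ZMod p × ZMod p)) ×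
    ((ZMod p × ZMod p) × (ZMod p × ZMod p)))) :=
  (eqDiffQuads D u v ×ˢ eqDiffQuads D u v).filter fun x =>
    -(v x.1.1.2.1 - v x.1.1.2.2) = -(v x.2.1.2.1 - v x.2.1.2.2) ∧
    v x.1.2.2.1 - v x.1.2.2.2 = v x.2.2.2.1 - v x.2.2.2.2 ∧
    u x.1.1.1.2 - u x.1.1.2.2 - u x.1.2.1.2 + u x.1.2.2.2 =
      u x.2.1.1.2 - u x.2.1.2.2 - u x.2.2.1.2 + u x.2.2.2.2 ∧
    -(v x.1.1.1.2 - v x.1.1.2.2 - v x.1.2.1.2 + v x.1.2.2.2) =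
      -(v x.2.1.1.2 - v x.2.1.2.2 - v x.2.2.1.2 + v x.2.2.2.2)

lemma expAvgDiff_eq (n m : ZMod p) (h : ZMod p × ZMod p) :
    expAvgDiff D u v n m h = (p : ℂ)⁻¹ ^ 2 * ∑ w ∈ D ×ˢ D,
      ep p (n * (u w.1 - u w.2) + (m * (v w.1 - v w.2) + (h.1 * u w.2 - h.2 * v w.2))) := by
  rw [expAvgDiff, expAvg, expAvg, map_mul, mul_mul_mul_comm, expSum_mul_conj, map_inv₀,
    Complex.conj_natCast, sq]
  congr 1
  refine Finset.sum_congr rfl fun w _ => ?_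
  congr 1
  ring

lemma expAvgGram_eq (m m' : ZMod p) (h : ZMod p × ZMod p) :
    expAvgGram D u v m m' h = (p : ℂ)⁻¹ ^ 3 * ∑ s ∈ eqDiffPairs D u,
      ep p (m' * (v s.1.1 - v s.1.2) + ((h.1 * u s.1.2 - h.2 * v s.1.2) -
        (m * (v s.2.1 - v s.2.2) + (h.1 * u s.2.2 - h.2 * v s.2.2)))) := by
  have hp : (p : ℂ) ≠ 0 := NeZero.ne _
  simp only [expAvgGram, expAvgDiff_eq, map_mul, map_pow, map_inv₀, Complex.conj_natCast]
  simp only [mul_mul_mul_comm _ _ ((p : ℂ)⁻¹ ^ 2), ← Finset.mul_sum]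
  rw [sum_expSum_mul_conj, ← mul_assoc]
  congr 1
  · field_simp
  · rw [eqDiffPairs]
    refine Finset.sum_congr rfl fun s _ => ?_
    congr 1
    ring

lemma sum_expAvgGram_mul_conj (m m' : ZMod p) (h : ZMod p × ZMod p) :
    ∑ k, expAvgGram D u v m k h * conj (expAvgGram D u v m' k h) =
      (p : ℂ)⁻¹ ^ 5 * ∑ r ∈ eqDiffQuads D u v,
        ep p (m * -(v r.1.2.1 - v r.1.2.2) + m' * (v r.2.2.1 - v r.2.2.2) +
          (h.1 * (u r.1.1.2 - u r.1.2.2 - u r.2.1.2 + u r.2.2.2) +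
            h.2 * -(v r.1.1.2 - v r.1.2.2 - v r.2.1.2 + v r.2.2.2))) := by
  have hp : (p : ℂ) ≠ 0 := NeZero.ne _
  simp only [expAvgGram_eq, map_mul, map_pow, map_inv₀, Complex.conj_natCast]
  simp only [mul_mul_mul_comm _ _ ((p : ℂ)⁻¹ ^ 3), ← Finset.mul_sum]
  rw [sum_expSum_mul_conj, ← mul_assoc]
  congr 1
  · field_simp
  · rw [eqDiffQuads]
    refine Finset.sum_congr rfl fun r _ => ?_
    congr 1
    ring

lemma sum_norm_sq_expAvgGram :
    ∑ m, ∑ m', ∑ h, ‖∑ k, expAvgGram D u v m k h * conj (expAvgGram D u v m' k h)‖ ^ 2 =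
      (eqPhasePairs D u v).card / (p : ℝ) ^ 6 := by
  have hp : (p : ℝ) ≠ 0 := NeZero.ne _
  simp only [sum_expAvgGram_mul_conj, norm_mul, mul_pow, ← Finset.mul_sum]
  rw [sum_norm_sq_expSum, ← eqPhasePairs, norm_pow, norm_inv, Complex.norm_natCast]
  generalize ((eqPhasePairs D u v).card : ℝ) = c
  field_simp

end Kernel

/-- Sixteen-tuples as nested pairs, in the order in which the variables arise from
iterated Cauchy–Schwarz. -/
def finSixteenEquivNested (α : Type*) : (Fin 16 → α) ≃
    ((((α × α) × (α × α)) × ((α × α) × (α × α))) ×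
      (((α × α) × (α × α)) × ((α × α) × (α × α)))) where
  toFun y := ((((y 3, y 11), (y 1, y 9)), ((y 7, y 15), (y 5, y 13))),
    (((y 2, y 10), (y 0, y 8)), ((y 6, y 14), (y 4, y 12))))
  invFun x := ![x.2.1.2.1, x.1.1.2.1, x.2.1.1.1, x.1.1.1.1, x.2.2.2.1, x.1.2.2.1, x.2.2.1.1,
    x.1.2.1.1, x.2.1.2.2, x.1.1.2.2, x.2.1.1.2, x.1.1.1.2, x.2.2.2.2, x.1.2.2.2, x.2.2.1.2,
    x.1.2.1.2]
  left_inv y := by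
    funext i
    fin_cases i <;> rfl
  right_inv _ := rfl

lemma finSixteenEquivNested_apply {α : Type*} (y : Fin 16 → α) :
    finSixteenEquivNested α y = ((((y 3, y 11), (y 1, y 9)), ((y 7, y 15), (y 5, y 13))),
      (((y 2, y 10), (y 0, y 8)), ((y 6, y 14), (y 4, y 12)))) := rfl

/-- The elements of `F_p` that are poles of neither `P` nor `Q`. -/
def regularPoints (p : ℕ) [NeZero p] (P Q : RatFunc ℚ) : Finset (ZMod p) :=
  Finset.univ.filter fun y => ¬ IsPole p P y ∧ ¬ IsPole p Q y

lemma rothCard_eq (p : ℕ) [NeZero p] (P Q : RatFunc ℚ) :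
    rothCard p P Q =
      (eqPhasePairs (regularPoints p P Q) (evalRed p P) (evalRed p Q)).card := by
  rw [rothCard, ← Nat.card_eq_finsetCard]
  refine Nat.card_congr ((finSixteenEquivNested (ZMod p)).subtypeEquiv fun y => ?_)
  simp only [finSixteenEquivNested_apply, eqPhasePairs, eqDiffQuads, eqDiffPairs,
    Finset.mem_filter, Finset.mem_product]
  constructor
  · rintro ⟨hP, hQ, e₁, e₂, e₃, e₄, e₅, e₆, e₇, e₈, e₉, e₁₀⟩
    have hD : ∀ i, y i ∈ regularPoints p P Q := fun i =>
      Finset.mem_filter.2 ⟨Finset.mem_univ _, hP i, hQ i⟩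
    simp only [hD, true_and, and_self]
    refine ⟨⟨⟨⟨?_, ?_⟩, ?_⟩, ⟨⟨?_, ?_⟩, ?_⟩⟩, ?_, ?_, ?_, ?_⟩
    · linear_combination -e₂
    · linear_combination -e₄
    · linear_combination e₇
    · linear_combination -e₁
    · linear_combination -e₃
    · linear_combination e₆
    · linear_combination e₅
    · linear_combination -e₈
    · linear_combination e₉
    · linear_combination -e₁₀
  · rintro ⟨⟨⟨⟨⟨⟨⟨h₃, h₁₁⟩, h₁, h₉⟩, e₂⟩, ⟨⟨h₇, h₁₅⟩, h₅, h₁₃⟩, e₄⟩, e₇⟩,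
      ⟨⟨⟨⟨h₂, h₁₀⟩, h₀, h₈⟩, e₁⟩, ⟨⟨h₆, h₁₄⟩, h₄, h₁₂⟩, e₃⟩, e₆⟩, e₅, e₈, e₉, e₁₀⟩
    have hD : ∀ i, y i ∈ regularPoints p P Q := by
      intro i
      fin_cases i <;> assumption
    refine ⟨fun i => (Finset.mem_filter.1 (hD i)).2.1, fun i => (Finset.mem_filter.1 (hD i)).2.2,
      ?_, ?_, ?_, ?_, ?_, ?_, ?_, ?_, ?_, ?_⟩
    · linear_combination -e₁
    · linear_combination -e₂
    · linear_combination -e₃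
    · linear_combination -e₄
    · linear_combination e₅
    · linear_combination e₆
    · linear_combination e₇
    · linear_combination -e₈
    · linear_combination e₉
    · linear_combination -e₁₀

section Counting

variable {p : ℕ} [NeZero p] (D : Finset (ZMod p)) (u v : ZMod p → ZMod p)

/-- The average over `y ∈ D` of `f₁(x₁ + u(y), x₂) f₂(x₁, x₂ + v(y))`. -/
def cornerDual (f1 f2 : ZMod p × ZMod p → ℂ) (x : ZMod p × ZMod p) : ℂ :=
  (p : ℂ)⁻¹ * ∑ y ∈ D, f1 (x.1 + u y, x.2) * f2 (x.1, x.2 + v y)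

lemma cornerDual_eq (f1 f2 : ZMod p × ZMod p → ℂ) (x : ZMod p × ZMod p) :
    cornerDual D u v f1 f2 x =
      ∑ k : ZMod p × ZMod p, (∑ n : ZMod p × ZMod p, dft p f1 n * dft p f2 (k - n) *
        expAvg D u v n.1 (k - n).2) * ep p (x.1 * k.1 + x.2 * k.2) := by
  calc cornerDual D u v f1 f2 x
      = ∑ n : ZMod p × ZMod p, ∑ m : ZMod p × ZMod p, dft p f1 n * dft p f2 m *
          expAvg D u v n.1 m.2 * ep p (x.1 * (n + m).1 + x.2 * (n + m).2) := by
        simp only [cornerDual, ← sum_dft_mul_ep f1 (_, _), ← sum_dft_mul_ep f2 (_, _), expAvg,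
          Finset.mul_sum, Finset.sum_mul]
        rw [Finset.sum_comm]
        refine Eq.trans ?_ Finset.sum_comm
        refine Finset.sum_congr rfl fun m _ => ?_
        rw [Finset.sum_comm]
        refine Finset.sum_congr rfl fun n _ => Finset.sum_congr rfl fun y _ => ?_
        have h : ep p ((x.1 + u y) * n.1 + x.2 * n.2) * ep p (x.1 * m.1 + (x.2 + v y) * m.2) =
            ep p (n.1 * u y + m.2 * v y) * ep p (x.1 * (n + m).1 + x.2 * (n + m).2) := by
          rw [← ep_add, ← ep_add, Prod.fst_add, Prod.snd_add]
          congr 1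
          ring
        linear_combination (p : ℂ)⁻¹ * dft p f1 n * dft p f2 m * h
    _ = _ := by
        simp only [Finset.sum_mul]
        refine Eq.trans ?_ Finset.sum_comm
        refine Finset.sum_congr rfl fun n _ => ?_
        rw [← Equiv.sum_comp (Equiv.addLeft n) fun k : ZMod p × ZMod p =>
          dft p f1 n * dft p f2 (k - n) * expAvg D u v n.1 (k - n).2 *
            ep p (x.1 * k.1 + x.2 * k.2)]
        simp only [Equiv.coe_addLeft, add_sub_cancel_left]

lemma sum_norm_sq_cornerDual (f1 f2 : ZMod p × ZMod p → ℂ) :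
    (((p : ℝ)⁻¹ ^ 2 * ∑ x, ‖cornerDual D u v f1 f2 x‖ ^ 2 : ℝ) : ℂ) =
      ∑ n1, ∑ h, F1 p f1 n1 h * ∑ m2, F2 p f2 m2 h * expAvgDiff D u v n1 m2 h := by
  simp only [cornerDual_eq]
  rw [sum_norm_sq_sum_mul_ep]
  push_cast
  simp only [← Complex.mul_conj', map_sum, map_mul, Finset.sum_mul_sum]
  calc ∑ k : ZMod p × ZMod p, ∑ n : ZMod p × ZMod p, ∑ n' : ZMod p × ZMod p,
        dft p f1 n * dft p f2 (k - n) * expAvg D u v n.1 (k - n).2 *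
          (conj (dft p f1 n') * conj (dft p f2 (k - n')) * conj (expAvg D u v n'.1 (k - n').2))
      = ∑ n : ZMod p × ZMod p, ∑ k : ZMod p × ZMod p, ∑ n' : ZMod p × ZMod p,
        dft p f1 n * dft p f2 (k - n) * expAvg D u v n.1 (k - n).2 *
          (conj (dft p f1 n') * conj (dft p f2 (k - n')) *
            conj (expAvg D u v n'.1 (k - n').2)) := Finset.sum_comm
    _ = ∑ n : ZMod p × ZMod p, ∑ m : ZMod p × ZMod p, ∑ h : ZMod p × ZMod p,
        dft p f1 n * conj (dft p f1 (n + -h)) * (dft p f2 m * conj (dft p f2 (m + h)) *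
          expAvgDiff D u v n.1 m.2 h) := by
        refine Finset.sum_congr rfl fun n _ => ?_
        rw [← Equiv.sum_comp (Equiv.addLeft n)]
        refine Finset.sum_congr rfl fun m _ => ?_
        rw [← Equiv.sum_comp (Equiv.subLeft n)]
        refine Finset.sum_congr rfl fun h _ => ?_
        have h₁ : n + m - (n - h) = m + h := by abel
        simp only [Equiv.coe_addLeft, Equiv.subLeft_apply, add_sub_cancel_left, h₁, expAvgDiff,
          ← sub_eq_add_neg, Prod.fst_sub, Prod.snd_add]
        ring
    _ = _ := by
        refine Eq.trans ?_ Finset.sum_comm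
        rw [Finset.sum_congr rfl fun n _ => Finset.sum_comm, Finset.sum_comm]
        refine Finset.sum_congr rfl fun h _ => ?_
        simp only [Fintype.sum_prod_type, F1, F2]
        refine Finset.sum_congr rfl fun n1 _ => ?_
        rw [Finset.sum_mul]
        refine Finset.sum_congr rfl fun n2 _ => ?_
        rw [Finset.mul_sum, Finset.sum_comm]
        refine Finset.sum_congr rfl fun m2 _ => ?_
        rw [Finset.sum_mul, Finset.mul_sum]

lemma norm_sum_mul_cornerDual_pow_le (f0 f1 f2 : ZMod p × ZMod p → ℂ) :
    ‖(p : ℂ)⁻¹ ^ 2 * ∑ x, f0 x * cornerDual D u v f1 f2 x‖ ^ 16 ≤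
      ((p : ℝ)⁻¹ ^ 2 * ∑ x, ‖f0 x‖ ^ 2) ^ 8 *
      (∑ n1, ∑ h, ‖F1 p f1 n1 h‖ ^ 2) ^ 4 *
      (∑ m2, ∑ h, ‖F2 p f2 m2 h‖ ^ 2) ^ 2 *
      (∑ m2', ∑ m2'', ∑ h, ‖conj (F2 p f2 m2' h) * F2 p f2 m2'' h‖ ^ 2) *
      ((eqPhasePairs D u v).card / (p : ℝ) ^ 6) := by
  set N : ℝ := (p : ℝ)⁻¹ ^ 2 * ∑ x, ‖f0 x‖ ^ 2 with hN
  set M : ℝ := (p : ℝ)⁻¹ ^ 2 * ∑ x, ‖cornerDual D u v f1 f2 x‖ ^ 2 with hM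
  set A : ℝ := ∑ n1, ∑ h, ‖F1 p f1 n1 h‖ ^ 2 with hA
  set B : ℝ := ∑ n1, ∑ h, ‖∑ m2, F2 p f2 m2 h * expAvgDiff D u v n1 m2 h‖ ^ 2 with hB
  have hN0 : 0 ≤ N := by positivity
  have hM0 : 0 ≤ M := by positivity
  have hA0 : 0 ≤ A := by positivity
  have hNM : ‖(p : ℂ)⁻¹ ^ 2 * ∑ x, f0 x * cornerDual D u v f1 f2 x‖ ^ 2 ≤ N * M := by
    rw [norm_mul, mul_pow, norm_pow, norm_inv, Complex.norm_natCast]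
    calc ((p : ℝ)⁻¹ ^ 2) ^ 2 * ‖∑ x, f0 x * cornerDual D u v f1 f2 x‖ ^ 2
        ≤ ((p : ℝ)⁻¹ ^ 2) ^ 2 *
          ((∑ x, ‖f0 x‖ ^ 2) * ∑ x, ‖cornerDual D u v f1 f2 x‖ ^ 2) := by
          gcongr
          exact norm_sum_mul_sq_le _ _
      _ = N * M := by rw [hN, hM]; ring
  have hMB : M ^ 2 ≤ A * B := by
    have h := norm_sum_sum_mul_sq_le (F1 p f1) fun n1 h =>
      ∑ m2, F2 p f2 m2 h * expAvgDiff D u v n1 m2 h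
    rwa [← sum_norm_sq_cornerDual, ← hM, Complex.norm_real, Real.norm_of_nonneg hM0] at h
  have hBY := sum_norm_sq_sum_mul_pow_le (F2 p f2) (expAvgDiff D u v) (expAvgGram D u v)
    fun _ _ _ => rfl
  rw [sum_norm_sq_expAvgGram, ← hB] at hBY
  calc ‖(p : ℂ)⁻¹ ^ 2 * ∑ x, f0 x * cornerDual D u v f1 f2 x‖ ^ 16
      = (‖(p : ℂ)⁻¹ ^ 2 * ∑ x, f0 x * cornerDual D u v f1 f2 x‖ ^ 2) ^ 8 := by ring
    _ ≤ (N * M) ^ 8 := by gcongr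
    _ = N ^ 8 * (M ^ 2) ^ 4 := by ring
    _ ≤ N ^ 8 * (A * B) ^ 4 := by gcongr
    _ = N ^ 8 * A ^ 4 * B ^ 4 := by ring
    _ ≤ N ^ 8 * A ^ 4 * _ := mul_le_mul_of_nonneg_left hBY (by positivity)
    _ = _ := by ring

end Counting

lemma cornerAvg_eq (p : ℕ) [NeZero p] (P Q : RatFunc ℚ) (f0 f1 f2 : ZMod p × ZMod p → ℂ) :
    cornerAvg p P Q f0 f1 f2 = (p : ℂ)⁻¹ ^ 2 * ∑ x, f0 x *
      cornerDual (regularPoints p P Q) (evalRed p P) (evalRed p Q) f1 f2 x := by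
  simp only [cornerAvg, cornerDual, regularPoints, Finset.sum_filter, Fintype.sum_prod_type,
    Finset.mul_sum]
  refine Finset.sum_congr rfl fun x1 _ => Finset.sum_congr rfl fun x2 _ =>
    Finset.sum_congr rfl fun y _ => ?_
  split_ifs
  · ring
  · simp only [mul_zero]

lemma mul_rpow_pow_sixteen {N A C E Y : ℝ} (hN : 0 ≤ N) (hA : 0 ≤ A) (hC : 0 ≤ C) (hE : 0 ≤ E)
    (hY : 0 ≤ Y) :
    (N ^ ((2:ℝ)⁻¹) * (A ^ ((2:ℝ)⁻¹)) ^ ((2:ℝ)⁻¹) * (C ^ ((2:ℝ)⁻¹)) ^ ((4:ℝ)⁻¹) *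
      (E ^ ((2:ℝ)⁻¹)) ^ ((8:ℝ)⁻¹) * Y ^ ((16:ℝ)⁻¹)) ^ 16 = N ^ 8 * A ^ 4 * C ^ 2 * E * Y := by
  have rpow_pow {x : ℝ} (hx : 0 ≤ x) (r : ℝ) (k : ℕ) (hr : r * (16 : ℕ) = k) :
      (x ^ r) ^ 16 = x ^ k := by
    rw [← Real.rpow_mul_natCast hx, hr, Real.rpow_natCast]
  simp only [mul_pow, ← Real.rpow_mul hA, ← Real.rpow_mul hC, ← Real.rpow_mul hE]
  rw [rpow_pow hN _ 8 (by norm_num), rpow_pow hA _ 4 (by norm_num), rpow_pow hC _ 2 (by norm_num),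
    rpow_pow hE _ 1 (by norm_num), rpow_pow hY _ 1 (by norm_num), pow_one, pow_one]

/-- **Proposition 3.3.** Intermediate step of the algebraic geometry PET induction. -/
theorem PET_intermediate (P Q : RatFunc ℚ) (p : ℕ) [Fact p.Prime]
    (hP : Admissible p P) (hQ : Admissible p Q)
    (f0 f1 f2 : ZMod p × ZMod p → ℂ) :
    ‖cornerAvg p P Q f0 f1 f2‖ ≤
      Lnorm p 2 f0 *
      ((∑ n1 : ZMod p, ∑ h : ZMod p × ZMod p, ‖F1 p f1 n1 h‖ ^ 2) ^ ((2:ℝ)⁻¹)) ^ ((2:ℝ)⁻¹) *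
      ((∑ m2 : ZMod p, ∑ h : ZMod p × ZMod p, ‖F2 p f2 m2 h‖ ^ 2) ^ ((2:ℝ)⁻¹)) ^ ((4:ℝ)⁻¹) *
      ((∑ m2' : ZMod p, ∑ m2'' : ZMod p, ∑ h : ZMod p × ZMod p,
          ‖(starRingEnd ℂ) (F2 p f2 m2' h) * F2 p f2 m2'' h‖ ^ 2) ^ ((2:ℝ)⁻¹)) ^ ((8:ℝ)⁻¹) *
      ((rothCard p P Q : ℝ) / (p : ℝ) ^ 6) ^ ((16:ℝ)⁻¹) := by
  have h := norm_sum_mul_cornerDual_pow_le (regularPoints p P Q) (evalRed p P) (evalRed p Q)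
    f0 f1 f2
  rw [← cornerAvg_eq, ← rothCard_eq] at h
  refine le_of_pow_le_pow_left₀ (n := 16) (by norm_num) (by unfold Lnorm; positivity)
    (h.trans_eq ?_)
  simp only [Lnorm, Real.rpow_two]
  exact (mul_rpow_pow_sixteen (by positivity) (by positivity) (by positivity) (by positivity)
    (by positivity)).symm

end RatCorners
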